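/- Let R be a principal ideal domain, ≻ a monomial ordering on the monomials of R[x_1,…,x_n], and B = {b_1,…,b_s} a finite set of nonconstant polynomials (b_j ∈ R[x_1,…,x_n] \ R). Then for every f ∈ R[x_1,…,x_n] the pseudo-division of f by B can be performed so that in the resulting identity λ·f = Σ_{j=1}^s q_j·b_j + r, with r pseudo-reduced with respect to B and lm(f) = max{max_j lm(q_j·b_j), lm(r)} (over the nonzero summands), every prime element p of R dividing the multiplier λ divides lc(b_j) for some j; in particular, if a prime p ∈ R is coprime to lc(b_j) for all j, then the multiplier λ can be chosen coprime to p. -/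

import Mathlib

open MvPolynomial

/-- A monomial ordering on the monomials (exponent vectors) in `m` variables:
a well-ordering compatible with addition of exponents. -/
structure MonomialOrdering (m : ℕ) where
  lin : LinearOrder (Fin m →₀ ℕ)
  wf : WellFounded lin.lt
  add_lt_add : ∀ a b c : Fin m →₀ ℕ, lin.lt a b → lin.lt (a + c) (b + c)

variable {m : ℕ}

open Classical in
/-- Leading monomial of `f` (junk value `0` for `f = 0`). -/
noncomputable def lmon {R : Type*} [CommRing R] (mo : MonomialOrdering m)
    (f : MvPolynomial (Fin m) R) : Fin m →₀ ℕ :=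
  letI := mo.lin
  if h : f = 0 then 0
  else f.support.max' (Finset.nonempty_iff_ne_empty.mpr
    (fun he => h (MvPolynomial.support_eq_empty.mp he)))

/-- Leading coefficient of `f`. -/
noncomputable def lcoeff {R : Type*} [CommRing R] (mo : MonomialOrdering m)
    (f : MvPolynomial (Fin m) R) : R :=
  f.coeff (lmon mo f)

/-- Leading term of `f`, as a polynomial. -/
noncomputable def lterm {R : Type*} [CommRing R] (mo : MonomialOrdering m)
    (f : MvPolynomial (Fin m) R) : MvPolynomial (Fin m) R :=
  MvPolynomial.monomial (lmon mo f) (lcoeff mo f)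

/-- `f` is a nonconstant polynomial, i.e. `f ∉ R`. -/
def Nonconst {R : Type*} [CommRing R] (f : MvPolynomial (Fin m) R) : Prop :=
  ∀ c : R, f ≠ MvPolynomial.C c

/-- `r` is pseudo-reduced with respect to `B`: no monomial in the support of `r` is
divisible by the leading monomial of an element of `B` (in particular `r = 0` is
pseudo-reduced). -/
def PseudoReduced {R : Type*} [CommRing R] (mo : MonomialOrdering m)
    (B : Finset (MvPolynomial (Fin m) R)) (r : MvPolynomial (Fin m) R) : Prop :=
  ∀ α ∈ r.support, ∀ b ∈ B, ¬ ∃ δ, α = lmon mo b + δ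

namespace MonomialOrdering

variable (mo : MonomialOrdering m)

lemma le_iff_eq_or_lt (a b : Fin m →₀ ℕ) : mo.lin.le a b ↔ a = b ∨ mo.lin.lt a b :=
  @_root_.le_iff_eq_or_lt _ mo.lin.toPartialOrder a b

lemma add_le_add {a b : Fin m →₀ ℕ} (h : mo.lin.le a b) (c : Fin m →₀ ℕ) :
    mo.lin.le (a + c) (b + c) := by
  rw [mo.le_iff_eq_or_lt] at h ⊢
  rcases h with rfl | h
  · exact Or.inl rfl
  · exact Or.inr (mo.add_lt_add _ _ _ h)

end MonomialOrdering

section LeadingMonomial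

variable {R : Type*} [CommRing R] (mo : MonomialOrdering m)

lemma lmon_mem_support {f : MvPolynomial (Fin m) R} (hf : f ≠ 0) : lmon mo f ∈ f.support := by
  let := mo.lin
  rw [lmon, dif_neg hf]
  exact Finset.max'_mem _ _

lemma le_lmon {f : MvPolynomial (Fin m) R} {α : Fin m →₀ ℕ} (hα : α ∈ f.support) :
    mo.lin.le α (lmon mo f) := by
  have hf : f ≠ 0 := by
    rintro rfl
    simp at hα
  let := mo.lin
  rw [lmon, dif_neg hf]
  exact Finset.le_max' _ _ hα

lemma lcoeff_ne_zero {f : MvPolynomial (Fin m) R} (hf : f ≠ 0) : lcoeff mo f ≠ 0 :=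
  mem_support_iff.mp (lmon_mem_support mo hf)

lemma Nonconst.ne_zero {f : MvPolynomial (Fin m) R} (hf : Nonconst f) : f ≠ 0 := by
  simpa using hf 0

/-- The polynomials all of whose monomials are at most `d`. -/
noncomputable def boundedBy (R : Type*) [CommRing R] (d : Fin m →₀ ℕ) :
    Submodule R (MvPolynomial (Fin m) R) :=
  restrictSupport R {α | mo.lin.le α d}

variable {mo}

lemma mem_boundedBy {d : Fin m →₀ ℕ} {f : MvPolynomial (Fin m) R} :
    f ∈ boundedBy mo R d ↔ ∀ α ∈ f.support, mo.lin.le α d :=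
  Iff.rfl

lemma mem_boundedBy_lmon (f : MvPolynomial (Fin m) R) : f ∈ boundedBy mo R (lmon mo f) :=
  mem_boundedBy.mpr fun _ => le_lmon mo

lemma lmon_le_of_mem_boundedBy {d : Fin m →₀ ℕ} {f : MvPolynomial (Fin m) R}
    (hf : f ∈ boundedBy mo R d) (h0 : f ≠ 0) : mo.lin.le (lmon mo f) d :=
  mem_boundedBy.mp hf _ (lmon_mem_support mo h0)

lemma lmon_eq_of_mem_boundedBy {d : Fin m →₀ ℕ} {f : MvPolynomial (Fin m) R}
    (hf : f ∈ boundedBy mo R d) (hd : f.coeff d ≠ 0) : f ≠ 0 ∧ lmon mo f = d := by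
  have h0 : f ≠ 0 := by
    rintro rfl
    simp at hd
  exact ⟨h0, mo.lin.le_antisymm _ _ (lmon_le_of_mem_boundedBy hf h0)
    (le_lmon mo (mem_support_iff.mpr hd))⟩

lemma boundedBy_mono {d e : Fin m →₀ ℕ} (h : mo.lin.le d e) :
    boundedBy mo R d ≤ boundedBy mo R e :=
  fun _ hf => mem_boundedBy.mpr fun α hα => mo.lin.le_trans _ _ _ (mem_boundedBy.mp hf α hα) h

lemma monomial_mem_boundedBy (d : Fin m →₀ ℕ) (c : R) : monomial d c ∈ boundedBy mo R d := by
  refine mem_boundedBy.mpr fun α hα => ?_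
  rw [Finset.mem_singleton.mp (support_monomial_subset hα)]
  exact mo.lin.le_refl d

lemma monomial_mul_mem_boundedBy (δ : Fin m →₀ ℕ) (c : R) (b : MvPolynomial (Fin m) R) :
    monomial δ c * b ∈ boundedBy mo R (lmon mo b + δ) := by
  classical
  refine mem_boundedBy.mpr fun α hα => ?_
  obtain ⟨β, hβ, γ, hγ, rfl⟩ := Finset.mem_add.mp (support_mul _ _ hα)
  rw [Finset.mem_singleton.mp (support_monomial_subset hβ), add_comm]
  exact mo.add_le_add (le_lmon mo hγ) δ

/-- The identity `lam * f = ∑ q b * b + r` with `r` pseudo-reduced, all summands bounded by `d`,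
and a nonzero multiplier whose prime divisors divide leading coefficients of `B`. -/
structure IsPseudoDivision (mo : MonomialOrdering m) (B : Finset (MvPolynomial (Fin m) R))
    (d : Fin m →₀ ℕ) (f : MvPolynomial (Fin m) R) (lam : R)
    (q : MvPolynomial (Fin m) R → MvPolynomial (Fin m) R) (r : MvPolynomial (Fin m) R) :
    Prop where
  ne_zero : lam ≠ 0
  eq : C lam * f = (∑ b ∈ B, q b * b) + r
  reduced : PseudoReduced mo B r
  quotient_mem : ∀ b ∈ B, q b * b ∈ boundedBy mo R d
  remainder_mem : r ∈ boundedBy mo R d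
  prime_dvd : ∀ p : R, Prime p → p ∣ lam → ∃ b ∈ B, p ∣ lcoeff mo b

lemma IsPseudoDivision.zero [Nontrivial R] (B : Finset (MvPolynomial (Fin m) R))
    (d : Fin m →₀ ℕ) : IsPseudoDivision mo B d 0 (1 : R) 0 0 where
  ne_zero := one_ne_zero
  eq := by simp
  reduced := fun α hα => by simp at hα
  quotient_mem := fun b _ => by simp
  remainder_mem := zero_mem _
  prime_dvd := fun p hp h => (hp.not_isUnit (isUnit_of_dvd_one h)).elim

lemma IsPseudoDivision.mono {B : Finset (MvPolynomial (Fin m) R)} {d e : Fin m →₀ ℕ}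
    {f : MvPolynomial (Fin m) R} {lam : R}
    {q : MvPolynomial (Fin m) R → MvPolynomial (Fin m) R} {r : MvPolynomial (Fin m) R}
    (h : IsPseudoDivision mo B d f lam q r) (hde : mo.lin.le d e) :
    IsPseudoDivision mo B e f lam q r :=
  { h with
    quotient_mem := fun b hb => boundedBy_mono hde (h.quotient_mem b hb)
    remainder_mem := boundedBy_mono hde h.remainder_mem }

/-- Undo one reduction step `f ↦ lcoeff b * f - monomial δ c * b`. -/
lemma IsPseudoDivision.of_reduce [IsDomain R] [DecidableEq (MvPolynomial (Fin m) R)]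
    {B : Finset (MvPolynomial (Fin m) R)}
    {f : MvPolynomial (Fin m) R} {lam : R}
    {q : MvPolynomial (Fin m) R → MvPolynomial (Fin m) R} {r b : MvPolynomial (Fin m) R}
    {δ : Fin m →₀ ℕ} {c : R} (hb : b ∈ B) (hb0 : b ≠ 0)
    (h : IsPseudoDivision mo B (lmon mo b + δ) (C (lcoeff mo b) * f - monomial δ c * b) lam q r) :
    IsPseudoDivision mo B (lmon mo b + δ) f (lam * lcoeff mo b)
      (q + Pi.single b (C lam * monomial δ c)) r where
  ne_zero := mul_ne_zero h.ne_zero (lcoeff_ne_zero mo hb0)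
  eq := by
    have hsum : ∑ x ∈ B, Pi.single (M := fun _ => MvPolynomial (Fin m) R) b
        (C lam * monomial δ c) x * x = C lam * monomial δ c * b := by
      rw [Finset.sum_eq_single_of_mem b hb, Pi.single_eq_same]
      intro x _ hx
      rw [Pi.single_eq_of_ne hx, zero_mul]
    simp only [Pi.add_apply, add_mul, Finset.sum_add_distrib, hsum, C_mul]
    linear_combination h.eq
  reduced := h.reduced
  quotient_mem := fun x hx => by
    rw [Pi.add_apply, add_mul]
    refine add_mem (h.quotient_mem x hx) ?_
    by_cases hxb : x = b
    · subst hxb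
      rw [Pi.single_eq_same, mul_assoc, ← smul_eq_C_mul]
      exact Submodule.smul_mem _ _ (monomial_mul_mem_boundedBy δ c x)
    · rw [Pi.single_eq_of_ne hxb, zero_mul]
      exact zero_mem _
  remainder_mem := h.remainder_mem
  prime_dvd := fun p hp hdvd =>
    (hp.dvd_or_dvd hdvd).elim (h.prime_dvd p hp) fun h' => ⟨b, hb, h'⟩

/-- Undo the transfer of an irreducible term to the remainder. -/
lemma IsPseudoDivision.of_sub_monomial {B : Finset (MvPolynomial (Fin m) R)}
    {f : MvPolynomial (Fin m) R} {lam : R}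
    {q : MvPolynomial (Fin m) R → MvPolynomial (Fin m) R} {r : MvPolynomial (Fin m) R}
    {d : Fin m →₀ ℕ} {c : R} (hd : ∀ b ∈ B, ¬ ∃ δ, d = lmon mo b + δ)
    (h : IsPseudoDivision mo B d (f - monomial d c) lam q r) :
    IsPseudoDivision mo B d f lam q (r + C lam * monomial d c) where
  ne_zero := h.ne_zero
  eq := by linear_combination h.eq
  reduced := fun α hα => by
    classical
    rcases Finset.mem_union.mp (support_add hα) with hα | hα
    · exact h.reduced α hα
    · rw [C_mul_monomial] at hα
      rwa [Finset.mem_singleton.mp (support_monomial_subset hα)]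
  quotient_mem := h.quotient_mem
  remainder_mem := add_mem h.remainder_mem <| by
    rw [C_mul_monomial]
    exact monomial_mem_boundedBy d _
  prime_dvd := h.prime_dvd

theorem exists_isPseudoDivision [IsDomain R] {B : Finset (MvPolynomial (Fin m) R)}
    (hB : ∀ b ∈ B, b ≠ 0) (d : Fin m →₀ ℕ) :
    ∀ f ∈ boundedBy mo R d, ∃ lam q r, IsPseudoDivision mo B d f lam q r := by
  classical
  induction d using mo.wf.induction with
  | _ d ih =>
    have step : ∀ g ∈ boundedBy mo R d, g.coeff d = 0 →
        ∃ lam q r, IsPseudoDivision mo B d g lam q r := by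
      intro g hg hgd
      by_cases hg0 : g = 0
      · subst hg0
        exact ⟨1, 0, 0, .zero B d⟩
      have hle := lmon_le_of_mem_boundedBy hg hg0
      have hlt : mo.lin.lt (lmon mo g) d := by
        refine ((mo.le_iff_eq_or_lt _ _).mp hle).resolve_left fun h => ?_
        exact mem_support_iff.mp (lmon_mem_support mo hg0) (h ▸ hgd)
      obtain ⟨lam, q, r, h⟩ := ih _ hlt g (mem_boundedBy_lmon g)
      exact ⟨lam, q, r, h.mono hle⟩
    intro f hf
    by_cases hd : ∃ b ∈ B, ∃ δ, d = lmon mo b + δ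
    · obtain ⟨b, hb, δ, rfl⟩ := hd
      obtain ⟨lam, q, r, h⟩ := step
        (C (lcoeff mo b) * f - monomial δ (f.coeff (lmon mo b + δ)) * b)
        (sub_mem (by rw [← smul_eq_C_mul]; exact Submodule.smul_mem _ _ hf)
          (monomial_mul_mem_boundedBy δ _ b))
        (by
          rw [coeff_sub, coeff_C_mul, add_comm (lmon mo b) δ, coeff_monomial_mul, _root_.lcoeff]
          ring)
      exact ⟨_, _, _, h.of_reduce hb (hB b hb)⟩
    · push Not at hd
      obtain ⟨lam, q, r, h⟩ := step (f - monomial d (f.coeff d))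
        (sub_mem hf (monomial_mem_boundedBy d _)) (by simp)
      exact ⟨_, _, _, h.of_sub_monomial fun b hb ⟨δ, hδ⟩ => hd b hb δ hδ⟩

end LeadingMonomial

/-- Pseudo-division over a PID can be performed so that every prime `p` dividing the
multiplier `λ` divides the leading coefficient of some element of `B`; in particular, if a
prime `p` is coprime to all leading coefficients of `B` then `λ` can be chosen coprime
to `p`. -/
theorem pseudo_division_multiplier_primes {R : Type*} [CommRing R] [IsDomain R]
    [IsPrincipalIdealRing R] (mo : MonomialOrdering m)
    (B : Finset (MvPolynomial (Fin m) R)) (hBne : B.Nonempty)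
    (hBnc : ∀ b ∈ B, Nonconst b)
    (f : MvPolynomial (Fin m) R) :
    ∃ (lam : R) (q : MvPolynomial (Fin m) R → MvPolynomial (Fin m) R)
      (r : MvPolynomial (Fin m) R),
      lam ≠ 0 ∧
      MvPolynomial.C lam * f = (∑ b ∈ B, q b * b) + r ∧
      PseudoReduced mo B r ∧
      (∀ b ∈ B, q b * b ≠ 0 → mo.lin.le (lmon mo (q b * b)) (lmon mo f)) ∧
      (r ≠ 0 → mo.lin.le (lmon mo r) (lmon mo f)) ∧
      (f ≠ 0 → (r ≠ 0 ∧ lmon mo r = lmon mo f) ∨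
        ∃ b ∈ B, q b * b ≠ 0 ∧ lmon mo (q b * b) = lmon mo f) ∧
      (∀ p : R, Prime p → p ∣ lam → ∃ b ∈ B, p ∣ lcoeff mo b) ∧
      (∀ p : R, Prime p → (∀ b ∈ B, ¬ p ∣ lcoeff mo b) → ¬ p ∣ lam) := by
  obtain ⟨lam, q, r, h⟩ := exists_isPseudoDivision (fun b hb => (hBnc b hb).ne_zero) (lmon mo f) f
    (mem_boundedBy_lmon (mo := mo) f)
  refine ⟨lam, q, r, h.ne_zero, h.eq, h.reduced,
    fun b hb => lmon_le_of_mem_boundedBy (h.quotient_mem b hb),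
    lmon_le_of_mem_boundedBy h.remainder_mem, fun hf => ?_, h.prime_dvd, ?_⟩
  · by_contra! hcon
    have hr : r.coeff (lmon mo f) = 0 := by
      by_contra h0
      obtain ⟨hr0, hr⟩ := lmon_eq_of_mem_boundedBy h.remainder_mem h0
      exact hcon.1 hr0 hr
    have hq : ∀ b ∈ B, (q b * b).coeff (lmon mo f) = 0 := by
      intro b hb
      by_contra h0
      obtain ⟨hq0, hq⟩ := lmon_eq_of_mem_boundedBy (h.quotient_mem b hb) h0
      exact hcon.2 b hb hq0 hq
    have heq := congrArg (coeff (lmon mo f)) h.eq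
    rw [coeff_C_mul, coeff_add, coeff_sum, Finset.sum_eq_zero hq, hr, add_zero] at heq
    exact mul_ne_zero h.ne_zero (lcoeff_ne_zero mo hf) heq
  · intro p hp hpB hdvd
    obtain ⟨b, hb, hpb⟩ := h.prime_dvd p hp hdvd
    exact hpB b hb hpb
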